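/- Let w be an infinite word on an alphabet A whose set P(w) of lengths of palindromic prefixes is infinite, with increasing enumeration (n_i)_{i≥1}. Then w has abundant palindromic prefixes (i.e. n_{i+1} ≤ 2n_i + 1 for all i ≥ 1) if and only if there exists a reduced admissible function ψ with w = w_ψ. Moreover such a reduced ψ is unique: if ψ and ψ' are reduced admissible functions with w_ψ = w_{ψ'}, then ψ = ψ'. -/

import Mathlib

open Filter

/-- The prefix of length `n` of the infinite word `w`. -/
def pref {A : Type*} (w : ℕ → A) (n : ℕ) : List A := (List.range n).map w

/-- The predicate "the prefix of `w` of length `n` is a palindrome". -/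
def palP {A : Type*} (w : ℕ → A) : ℕ → Prop := fun n => (pref w n).Palindrome

/-- An admissible function: index `i : ℕ` stands for the paper's index `i + 1`, and the
value `Sum.inr j` stands for the paper's integer value `j + 1`; so the paper's condition
`1 ≤ ψ(n) ≤ n - 1` becomes `j < i`. -/
def Admissible {A : Type*} (ψ : ℕ → A ⊕ ℕ) : Prop :=
  ∀ i j, ψ i = Sum.inr j → j < i

/-- The set `S(ψ)` of indices `n` with `ψ(n) ∈ A` or `ψ(n) ≤ n - 2` (in the paper's
indexing; here `i` stands for `n = i + 1` and `Sum.inr j` for the value `j + 1`). -/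
def Sset {A : Type*} (ψ : ℕ → A ⊕ ℕ) : Set ℕ :=
  {i | (∃ a, ψ i = Sum.inl a) ∨ ∃ j, ψ i = Sum.inr j ∧ j + 2 ≤ i}

/-- `m < n` are consecutive elements of `S`. -/
def ConsecIn (S : Set ℕ) (m n : ℕ) : Prop :=
  m ∈ S ∧ n ∈ S ∧ m < n ∧ ∀ k ∈ S, ¬(m < k ∧ k < n)

/-- `ψ` is reduced: for consecutive `m < n` in `S(ψ)`, `ψ(n) ≠ ψ(m)` and either
`ψ(n) ∈ A` or `ψ(n) < m` (in the paper's indexing: `Sum.inr j` stands for the value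
`j + 1` and `m` for the index `m + 1`, so the paper's `ψ(n) < m` becomes `j < m`). -/
def Reduced {A : Type*} (ψ : ℕ → A ⊕ ℕ) : Prop :=
  ∀ m n, ConsecIn (Sset ψ) m n →
    ψ n ≠ ψ m ∧ ((∃ a, ψ n = Sum.inl a) ∨ ∃ j, ψ n = Sum.inr j ∧ j < m)

/-- The palindromes `π_i` associated with `ψ` (`piW ψ i` is the paper's `π_{i+1}`):
`π_1 = ε`; `π_{i+1} = π_i a π_i` if `ψ(i) = a ∈ A`, and `π_{i+1} = π_i u` where `u` is
`π_i` with its first `|π_j|` letters deleted if `ψ(i) = j ∈ ℕ*`. (The `min j i` is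
irrelevant when `ψ` is admissible, since then `j < i`.) -/
def piW {A : Type*} (ψ : ℕ → A ⊕ ℕ) : ℕ → List A
  | 0 => []
  | (i + 1) =>
    match ψ i with
    | Sum.inl a => piW ψ i ++ a :: piW ψ i
    | Sum.inr j => piW ψ i ++ (piW ψ i).drop (piW ψ (min j i)).length

/-- The sequence `(n_i)` associated with `ψ` (`nseq ψ i` is the paper's `n_{i+1}`). -/
def nseq {A : Type*} (ψ : ℕ → A ⊕ ℕ) : ℕ → ℕ
  | 0 => 0
  | (i + 1) =>
    match ψ i with
    | Sum.inl _ => 2 * nseq ψ i + 1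
    | Sum.inr j => 2 * nseq ψ i - nseq ψ (min j i)

/-- `δ(ψ) = limsup n_{i+1} / n_i`. -/
noncomputable def deltaPsi {A : Type*} (ψ : ℕ → A ⊕ ℕ) : ENNReal :=
  limsup (fun i => (nseq ψ (i + 1) : ENNReal) / (nseq ψ i : ENNReal)) atTop

def WPal {A : Type*} (w : ℕ → A) (n : ℕ) : Prop := ∀ x y, x + y + 1 = n → w x = w y

def WPer {A : Type*} (w : ℕ → A) (N p : ℕ) : Prop := ∀ x, x + p < N → w x = w (x + p)

theorem pref_length {A : Type*} (w : ℕ → A) (n : ℕ) : (pref w n).length = n := by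
  simp [pref]

theorem palP_iff {A : Type*} (w : ℕ → A) (n : ℕ) : palP w n ↔ WPal w n := by
  unfold palP
  rw [List.Palindrome.iff_reverse_eq]
  constructor
  · intro h x y hxy
    have h1 : (pref w n).reverse[x]'(by simp [pref]; omega) = (pref w n)[x]'(by simp [pref]; omega) := by
      simp only [h]
    simp [pref] at h1
    rw [← h1]; congr 1; omega
  · intro h
    apply List.ext_getElem
    · simp
    · intro x h1 h2
      simp [pref] at h1 h2 ⊢
      apply h; omega

theorem per_of_pal {A : Type*} {w : ℕ → A} {N p : ℕ} (hN : WPal w N) (hp : p ≤ N)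
    (hM : WPal w (N - p)) : WPer w N p := by
  intro x hx
  rw [hM x (N - p - 1 - x) (by omega), hN (N - p - 1 - x) (x + p) (by omega)]

theorem pal_of_per {A : Type*} {w : ℕ → A} {N p : ℕ} (hN : WPal w N)
    (hp : WPer w N p) : WPal w (N - p) := by
  intro x y hx
  rw [hp x (by omega), hN (x + p) y (by omega)]

theorem pal_extend {A : Type*} {w : ℕ → A} {M p : ℕ} (hM : WPal w M) (h : p ≤ M + 1)
    (hp : WPer w (M + p) p) : WPal w (M + p) := by
  intro x y hx
  by_cases h1 : x < M
  · rw [hM x (M - 1 - x) (by omega), hp _ (by omega)]; congr 1; omega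
  · by_cases h2 : y < M
    · rw [hM y (M - 1 - y) (by omega), hp (M - 1 - y) (by omega)]; congr 1; omega
    · congr 1; omega

theorem per_mono {A : Type*} {w : ℕ → A} {N M p : ℕ} (h : WPer w N p) (hM : M ≤ N) :
    WPer w M p := fun x hx => h x (by omega)

theorem per_mul {A : Type*} {w : ℕ → A} {N p : ℕ} (h : WPer w N p) (x k : ℕ)
    (hx : x + k * p < N) : w x = w (x + k * p) := by
  induction k with
  | zero => simp
  | succ k ih =>
    have e : (k + 1) * p = k * p + p := by ring
    rw [e] at hx ⊢
    rw [ih (by omega), h _ (by omega)]; congr 1; omega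

theorem per_of_mul {A : Type*} {w : ℕ → A} {N K p k : ℕ} (hK : K = k * p) (hK0 : 0 < K)
    (h1 : WPer w K p) (h2 : WPer w N K) : WPer w N p := by
  intro x
  induction x using Nat.strong_induction_on with
  | _ x ih =>
    intro hx
    by_cases c1 : x + p < K
    · exact h1 x c1
    · by_cases c2 : K ≤ x
      · have a1 := h2 (x - K) (by omega)
        have a2 := h2 (x - K + p) (by omega)
        have a3 := ih (x - K) (by omega) (by omega)
        rw [show x - K + K = x by omega] at a1
        rw [show x - K + p + K = x + p by omega] at a2
        rw [← a1, ← a2, a3]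
      · have a1 := h2 (x + p - K) (by omega)
        rw [show x + p - K + K = x + p by omega] at a1
        rw [← a1]
        obtain _ | k := k
        · omega
        have e : (k + 1) * p = k * p + p := by ring
        have a2 := per_mul h1 (x + p - K) k (by omega)
        rw [a2]; congr 1; omega

theorem per_gcd {A : Type*} {w : ℕ → A} {N : ℕ} : ∀ s p q : ℕ, p + q = s → p + q ≤ N →
    WPer w N p → WPer w N q → WPer w N (Nat.gcd p q) := by
  intro s
  induction s using Nat.strong_induction_on with
  | _ s ih =>
    have key : ∀ p q, p + q = s → p + q ≤ N → 0 < p → p ≤ q →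
        WPer w N p → WPer w N q → WPer w N (Nat.gcd p q) := by
      intro p q hs hN hp0 hpq hp hq
      have h := ih (p + (q - p)) (by omega) p (q - p) rfl (by omega) hp (by
        intro x hx
        by_cases c : p ≤ x
        · have a1 := hp (x - p) (by omega)
          have a2 := hq (x - p) (by omega)
          rw [show x - p + p = x by omega] at a1
          rw [← a1, a2]; congr 1; omega
        · have a1 := hq x (by omega)
          have a2 := hp (x + (q - p)) (by omega)
          rw [a1, a2]; congr 1; omega)
      rwa [Nat.gcd_sub_self_right hpq] at h
    intro p q hs hN hp hq
    rcases Nat.eq_zero_or_pos p with h0 | h0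
    · subst h0; simpa using hq
    rcases Nat.eq_zero_or_pos q with h0' | h0'
    · subst h0'; simpa using hp
    rcases le_total p q with h | h
    · exact key p q hs hN h0 h hp hq
    · rw [Nat.gcd_comm]; exact key q p (by omega) (by omega) h0' h hq hp

structure GoodSeq {A : Type*} (w : ℕ → A) (ψ : ℕ → A ⊕ ℕ) (n : ℕ → ℕ) : Prop where
  zero : n 0 = 0
  pal : ∀ i, WPal w (n i)
  step : ∀ i, (ψ i = Sum.inl (w (n i)) ∧ n (i + 1) = 2 * n i + 1) ∨
    ∃ j, j < i ∧ ψ i = Sum.inr j ∧ n (i + 1) + n j = 2 * n i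

theorem GoodSeq.mono {A : Type*} {w : ℕ → A} {ψ : ℕ → A ⊕ ℕ} {n : ℕ → ℕ}
    (h : GoodSeq w ψ n) : StrictMono n := by
  have key : ∀ i, ∀ j, j < i → n j < n i := by
    intro i
    induction i with
    | zero => intro j hj; omega
    | succ i ih =>
      have : n i < n (i + 1) := by
        rcases h.step i with ⟨_, h2⟩ | ⟨j, hj, _, h2⟩
        · omega
        · have := ih j hj; omega
      intro j hj
      rcases Nat.lt_succ_iff_lt_or_eq.mp hj with h' | h'
      · exact (ih j h').trans this
      · rw [h']; exact this
  intro a b hab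
  exact key b a hab

theorem GoodSeq.per {A : Type*} {w : ℕ → A} {ψ : ℕ → A ⊕ ℕ} {n : ℕ → ℕ}
    (h : GoodSeq w ψ n) (i : ℕ) : WPer w (n (i + 1)) (n (i + 1) - n i) := by
  have := h.mono (Nat.lt_succ_self i)
  refine per_of_pal (h.pal _) (by omega) ?_
  rw [show n (i + 1) - (n (i + 1) - n i) = n i by simp at this; omega]
  exact h.pal i

/-- arithmetic progression between consecutive elements of S -/
theorem GoodSeq.prog {A : Type*} {w : ℕ → A} {ψ : ℕ → A ⊕ ℕ} {n : ℕ → ℕ}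
    (h : GoodSeq w ψ n) {m i : ℕ} (hS : ∀ k ∈ Sset ψ, ¬(m < k ∧ k < i)) :
    ∀ k, m + k < i → n (m + k) = n m + k * (n (m + 1) - n m) ∧
      n (m + k + 1) = n (m + k) + (n (m + 1) - n m) := by
  intro k
  induction k with
  | zero => intro _; have := h.mono (Nat.lt_succ_self m); simp at this ⊢; omega
  | succ k ih =>
    intro hk
    obtain ⟨h1, h2⟩ := ih (by omega)
    have hn : m + k + 1 ∉ Sset ψ := fun hc => hS _ hc ⟨by omega, by omega⟩
    refine ⟨by rw [← add_assoc, h2, h1]; ring, ?_⟩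
    rw [← add_assoc]
    rcases h.step (m + k + 1) with ⟨e, _⟩ | ⟨j, hj, e, e2⟩
    · exact absurd (Or.inl ⟨_, e⟩) hn
    · have : j = m + k := by
        by_contra hc
        exact hn (Or.inr ⟨j, e, by omega⟩)
      subst this
      omega

theorem GoodSeq.prog' {A : Type*} {w : ℕ → A} {ψ : ℕ → A ⊕ ℕ} {n : ℕ → ℕ}
    (h : GoodSeq w ψ n) {m i : ℕ} (hS : ∀ k ∈ Sset ψ, ¬(m < k ∧ k < i)) (k : ℕ)
    (hk : m + k ≤ i) : n (m + k) = n m + k * (n (m + 1) - n m) := by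
  cases k with
  | zero => simp
  | succ k =>
    obtain ⟨h1, h2⟩ := h.prog hS k (by omega)
    rw [← add_assoc, h2, h1]; ring

theorem GoodSeq.reduced {A : Type*} {w : ℕ → A} {ψ : ℕ → A ⊕ ℕ} {n : ℕ → ℕ}
    (h : GoodSeq w ψ n) (hall : ∀ N, WPal w N → ∃ i, N = n i) : Reduced ψ := by
  rintro m i ⟨hm, hi, hmi, hS⟩
  obtain ⟨L, rfl⟩ : ∃ L, i = m + (L + 1) := ⟨i - m - 1, by omega⟩
  set p := n (m + 1) - n m with hp
  have hmono := h.mono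
  have hp0 : 0 < p := by have := hmono (Nat.lt_succ_self m); simp at this; omega
  have hAP : ∀ k, k ≤ L + 1 → n (m + k) = n m + k * p := fun k hk =>
    h.prog' hS k (by omega)
  have hni := hAP (L + 1) le_rfl
  have hnL := hAP L (by omega)
  have e1 : (L + 1) * p = L * p + p := by ring
  have e2 : (L + 2) * p = L * p + p + p := by ring
  have hperi : WPer w (n (m + (L + 1))) p := by
    have := h.per (m + L)
    rwa [add_assoc, show n (m + (L + 1)) - n (m + L) = p by omega] at this
  have core : ∀ k, 2 ≤ k → n (m + (L + 1) + 1) = n (m + (L + 1)) + k * p →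
      WPer w (k * p) p → False := by
    intro k hk hd hper
    have hpp := h.per (m + (L + 1))
    rw [show n (m + (L + 1) + 1) - n (m + (L + 1)) = k * p by omega] at hpp
    have hkp : 2 * p ≤ k * p := Nat.mul_le_mul_right _ hk
    have h3 := per_of_mul rfl (by omega) hper hpp
    obtain ⟨t, ht⟩ := hall _ (pal_of_per (h.pal _) h3)
    have l1 : n (m + (L + 1)) < n t := by omega
    have l2 : n t < n (m + (L + 1) + 1) := by omega
    rw [hmono.lt_iff_lt] at l1 l2
    omega
  have hge2 : (L + 1) + 1 ≥ 2 := by omega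
  rcases h.step (m + (L + 1)) with ⟨e, hs⟩ | ⟨j, hj, e, hs⟩
  · refine ⟨?_, Or.inl ⟨_, e⟩⟩
    intro hc
    rcases h.step m with ⟨e', hs'⟩ | ⟨j', _, e', hs'⟩
    · rw [e, e'] at hc
      have hw : w (n (m + (L + 1))) = w (n m) := Sum.inl_injective hc
      refine core (L + 2) (by omega) (by omega) ?_
      intro x hx
      by_cases c : x + p < n (m + (L + 1))
      · exact hperi x c
      · rw [show x + p = n (m + (L + 1)) by omega, hw, show x = n m + L * p by omega]
        exact (per_mul hperi _ _ (by omega)).symm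
    · rw [e, e'] at hc; cases hc
  · have hjS : j + 2 ≤ m + (L + 1) := by
      rcases hi with ⟨a, ha⟩ | ⟨j', e', h'⟩
      · rw [e] at ha; cases ha
      · rw [e] at e'; cases e'; exact h'
    constructor
    · intro hc
      rcases h.step m with ⟨e', hs'⟩ | ⟨j', _, e', hs'⟩
      · rw [e, e'] at hc; cases hc
      · rw [e, e'] at hc; cases hc
        exact core (L + 2) (by omega) (by omega) (per_mono hperi (by omega))
    · refine Or.inr ⟨j, e, ?_⟩
      by_contra hc
      obtain ⟨t, rfl⟩ : ∃ t, j = m + t := ⟨j - m, by omega⟩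
      have ht := hAP t (by omega)
      obtain ⟨k, hk⟩ : ∃ k, L + 1 = t + k := ⟨L + 1 - t, by omega⟩
      have e3 : (L + 1) * p = t * p + k * p := by rw [hk]; ring
      exact core k (by omega) (by omega) (per_mono hperi (by omega))

theorem GoodSeq.gap {A : Type*} {w : ℕ → A} {ψ : ℕ → A ⊕ ℕ} {n : ℕ → ℕ}
    (h : GoodSeq w ψ n) (hred : Reduced ψ) :
    ∀ i N, WPal w N → n i < N → N < n (i + 1) → False := by
  classical
  have hmono := h.mono
  have h0S : 0 ∈ Sset ψ := by
    rcases h.step 0 with ⟨e, _⟩ | ⟨j, hj, _⟩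
    · exact Or.inl ⟨_, e⟩
    · omega
  intro i
  induction i using Nat.strong_induction_on with
  | _ i ih =>
  -- minimal periods of earlier palindromes
  have minper : ∀ t, t < i → ∀ g, 0 < g → g ≤ n (t + 1) → WPer w (n (t + 1)) g →
      n (t + 1) - n t ≤ g := by
    intro t ht g hg0 hg hper
    by_contra hc
    exact ih t ht _ (pal_of_per (h.pal _) hper) (by omega) (by omega)
  intro N hN hN1 hN2
  rcases Nat.eq_zero_or_pos i with rfl | hi0
  · rcases h.step 0 with ⟨_, e⟩ | ⟨j, hj, _⟩
    · have := h.zero; omega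
    · omega
  by_cases hiS : i ∈ Sset ψ
  swap
  · rcases h.step i with ⟨e, _⟩ | ⟨j, hj, e, e2⟩
    · exact hiS (Or.inl ⟨_, e⟩)
    have : j + 1 = i := by
      by_contra hc
      exact hiS (Or.inr ⟨j, e, by omega⟩)
    subst this
    have hjm := hmono (Nat.lt_succ_self j)
    simp at hjm
    have hper := per_mono (h.per (j + 1)) hN2.le
    exact ih j (by omega) _ (pal_of_per hN hper) (by omega) (by omega)
  -- predecessor
  obtain ⟨m, hmS, hmi, hS⟩ : ∃ m ∈ Sset ψ, m < i ∧ ∀ k ∈ Sset ψ, ¬(m < k ∧ k < i) := by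
    refine ⟨Nat.findGreatest (· ∈ Sset ψ) (i - 1),
      Nat.findGreatest_spec (P := (· ∈ Sset ψ)) (Nat.zero_le _) h0S, ?_, ?_⟩
    · have := Nat.findGreatest_le (P := (· ∈ Sset ψ)) (i - 1); omega
    · rintro k hk ⟨h1, h2⟩
      exact Nat.findGreatest_is_greatest h1 (by omega) hk
  obtain ⟨hne, hlow⟩ := hred m i ⟨hmS, hiS, hmi, hS⟩
  obtain ⟨L, rfl⟩ : ∃ L, i = m + (L + 1) := ⟨i - m - 1, by omega⟩
  set p := n (m + 1) - n m with hp
  have hmm := hmono (Nat.lt_succ_self m)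
  simp at hmm
  have hAP : ∀ k, k ≤ L + 1 → n (m + k) = n m + k * p := fun k hk =>
    h.prog' hS k (by omega)
  have hni := hAP (L + 1) le_rfl
  have hnL := hAP L (by omega)
  have e1 : (L + 1) * p = L * p + p := by ring
  have hperi : WPer w (n (m + (L + 1))) p := by
    have := h.per (m + L)
    rwa [add_assoc, show n (m + (L + 1)) - n (m + L) = p by omega] at this
  have hminp : ∀ g, 0 < g → g ≤ n (m + (L + 1)) → WPer w (n (m + (L + 1))) g → p ≤ g := by
    intro g hg0 hg hper
    have := minper (m + L) (by omega) g hg0 hg hper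
    rw [add_assoc] at this
    omega
  set Q := n (m + (L + 1) + 1) - n (m + (L + 1)) with hQ
  have hQper : WPer w (n (m + (L + 1) + 1)) Q := h.per _
  have hQle : Q ≤ n (m + (L + 1)) + 1 := by
    rcases h.step (m + (L + 1)) with ⟨_, e⟩ | ⟨j, _, _, e⟩ <;> omega
  have hex : ∃ R, 0 < R ∧ R < Q ∧ WPer w (n (m + (L + 1) + 1)) R := by
    refine ⟨n (m + (L + 1) + 1) - N, by omega, by omega, ?_⟩
    refine per_of_pal (h.pal _) (by omega) ?_
    rwa [show n (m + (L + 1) + 1) - (n (m + (L + 1) + 1) - N) = N by omega]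
  obtain ⟨hR0, hRQ, hR⟩ := Nat.find_spec hex
  have hRmin := fun R' => Nat.find_min (m := R') hex
  set R := Nat.find hex with hRdef
  have hRdvd : R ∣ Q := by
    have hg := per_gcd _ R Q rfl (by omega) hR hQper
    have hg0 : 0 < Nat.gcd R Q := Nat.gcd_pos_of_pos_left _ hR0
    have hgle : Nat.gcd R Q ≤ R := Nat.gcd_le_left _ hR0
    rcases hgle.lt_or_eq with hl | he
    · exact absurd ⟨hg0, by omega, hg⟩ (hRmin _ hl)
    · rw [← he]; exact Nat.gcd_dvd_right _ _
  obtain ⟨k, hk⟩ := hRdvd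
  rw [mul_comm] at hk
  have hk2 : 2 ≤ k := by
    by_contra hc
    have : k * R ≤ 1 * R := Nat.mul_le_mul_right _ (by omega)
    omega
  have hkR : 2 * R ≤ k * R := Nat.mul_le_mul_right _ hk2
  have hpR : p = R := by
    have hle := hminp R hR0 (by omega) (per_mono hR (by omega))
    rcases hle.lt_or_eq with hl | he
    swap
    · exact he
    exfalso
    have hg := per_gcd _ p R rfl (by omega) hperi (per_mono hR (by omega))
    have hg0 : 0 < Nat.gcd p R := Nat.gcd_pos_of_pos_right _ hR0
    have hgle : Nat.gcd p R ≤ p := Nat.gcd_le_left _ (by omega)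
    have hge := hminp _ hg0 (by omega) hg
    have hd : p ∣ R := by
      rw [← le_antisymm hgle hge]; exact Nat.gcd_dvd_right _ _
    obtain ⟨c, hc⟩ := hd
    have hpp : WPer w (n (m + (L + 1) + 1)) p :=
      per_of_mul (k := c) (by rw [hc, mul_comm]) hR0 (per_mono hperi (by omega)) hR
    exact hRmin p hl ⟨by omega, by omega, hpp⟩
  rw [← hpR] at hk hkR hR hRmin
  -- now Q = k * p
  have hmstep : p ≤ n m + 1 := by
    rcases h.step m with ⟨_, e⟩ | ⟨j, _, _, e⟩ <;> omega
  by_cases c1 : k ≤ L + 1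
  · obtain ⟨t, ht⟩ : ∃ t, L + 1 = t + k := ⟨L + 1 - k, by omega⟩
    have e3 : (L + 1) * p = t * p + k * p := by rw [ht]; ring
    have hnt := hAP t (by omega)
    rcases h.step (m + (L + 1)) with ⟨_, e⟩ | ⟨j, _, e, e'⟩
    · omega
    · have hj : n j = n (m + t) := by omega
      have hj' := hmono.injective hj
      rcases hlow with ⟨a, ha⟩ | ⟨j', ej, hj'm⟩
      · rw [e] at ha; cases ha
      · rw [e] at ej; cases ej; omega
  · obtain ⟨t, rfl⟩ : ∃ t, k = (L + 1) + (t + 1) := ⟨k - L - 2, by omega⟩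
    have e3 : (L + 1 + (t + 1)) * p = (L + 1) * p + t * p + p := by ring
    rcases Nat.eq_zero_or_pos t with rfl | ht
    · -- same value
      apply hne
      simp only [zero_mul] at e3
      rcases h.step (m + (L + 1)) with ⟨e, es⟩ | ⟨j, _, e, es⟩
      · rcases h.step m with ⟨f, fs⟩ | ⟨j', _, f, fs⟩
        · rw [e, f]; congr 1
          rw [hni]; exact (per_mul hR _ _ (by omega)).symm
        · have := hmono (Nat.lt_succ_self m); omega
      · rcases h.step m with ⟨f, fs⟩ | ⟨j', _, f, fs⟩
        · omega
        · rw [e, f]; congr 1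
          exact hmono.injective (by omega)
    · have htp : 1 * p ≤ t * p := Nat.mul_le_mul_right _ ht
      have hnm : 2 * p ≤ n m + 1 := by omega
      obtain _ | m := m
      · have := h.zero; omega
      have hmm' := hmono (Nat.lt_succ_self m)
      simp at hmm'
      have hperm : WPer w (n (m + 1 + 1)) p := h.per (m + 1)
      set p' := n (m + 1) - n m with hp'
      have hperm' : WPer w (n (m + 1)) p' := h.per m
      have hmin' := minper m (by omega)
      have hle := hmin' p (by omega) (by omega) (per_mono hperm (by omega))
      have hnep : p' ≠ p := by
        intro hc
        rcases h.step (m + 1) with ⟨e, es⟩ | ⟨j, _, e, es⟩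
        · omega
        · have hj : n j = n m := by omega
          have hj' := hmono.injective hj
          rcases hmS with ⟨a, ha⟩ | ⟨j'', ej, hj''⟩
          · rw [e] at ha; cases ha
          · rw [e] at ej; cases ej; omega
      have hg := per_gcd _ p' p rfl (by omega) hperm' (per_mono hperm (by omega))
      have hg0 : 0 < Nat.gcd p' p := Nat.gcd_pos_of_pos_left _ (by omega)
      have hgle : Nat.gcd p' p ≤ p' := Nat.gcd_le_left _ (by omega)
      have hge := hmin' _ hg0 (by omega) hg
      have hd : p' ∣ p := by
        rw [← le_antisymm hgle hge]; exact Nat.gcd_dvd_right _ _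
      obtain ⟨c, hc⟩ := hd
      have hpp : WPer w (n (m + 1 + 1)) p' :=
        per_of_mul (k := c) (by rw [hc, mul_comm]) (by omega) (per_mono hperm' (by omega)) hperm
      exact ih (m + 1) (by omega) _ (pal_of_per (h.pal _) hpp) (by omega) (by omega)

theorem GoodSeq.all {A : Type*} {w : ℕ → A} {ψ : ℕ → A ⊕ ℕ} {n : ℕ → ℕ}
    (h : GoodSeq w ψ n) (hred : Reduced ψ) (N : ℕ) (hN : WPal w N) : ∃ i, N = n i := by
  by_contra hc
  push Not at hc
  have key : ∀ i, n i < N := by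
    intro i
    induction i with
    | zero => have := hc 0; rw [h.zero] at this ⊢; omega
    | succ i ih =>
      rcases lt_trichotomy N (n (i + 1)) with h1 | h1 | h1
      · exact (h.gap hred i N hN ih h1).elim
      · exact absurd h1 (hc _)
      · exact h1
  have h1 := h.mono.id_le N
  have h2 := key N
  simp at h1
  omega

theorem goodSeq_of_pref {A : Type*} {w : ℕ → A} {ψ : ℕ → A ⊕ ℕ} (hadm : Admissible ψ)
    (h : ∀ i, pref w (piW ψ i).length = piW ψ i) :
    GoodSeq w ψ (fun i => (piW ψ i).length) := by
  have hget : ∀ i x (hx : x < (piW ψ i).length), (piW ψ i)[x] = w x := by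
    intro i x hx
    have h1 : (pref w (piW ψ i).length)[x]'(by simpa [pref] using hx) = (piW ψ i)[x] := by
      simp only [h]
    rw [← h1]; simp [pref]
  have hl : ∀ i a, ψ i = Sum.inl a → piW ψ (i + 1) = piW ψ i ++ a :: piW ψ i := by
    intro i a e; rw [piW]; simp only [e]
  have hr : ∀ i j, ψ i = Sum.inr j →
      piW ψ (i + 1) = piW ψ i ++ (piW ψ i).drop (piW ψ j).length := by
    intro i j e; rw [piW]; simp only [e]
    rw [min_eq_left (hadm i j e).le]
  have key : ∀ i, (∀ k, k ≤ i → WPal w (piW ψ k).length) ∧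
      (∀ k, k ≤ i → (piW ψ k).length ≤ (piW ψ i).length) := by
    intro i
    induction i with
    | zero =>
      constructor
      · intro k hk; obtain rfl : k = 0 := by omega
        intro x y hxy; simp [piW] at hxy
      · intro k hk; obtain rfl : k = 0 := by omega
        exact le_rfl
    | succ i ih =>
      obtain ⟨ih1, ih2⟩ := ih
      have main : WPal w (piW ψ (i + 1)).length ∧
          (piW ψ i).length ≤ (piW ψ (i + 1)).length := by
        rcases e : ψ i with a | j
        · have e' := hl i a e
          have hlen : (piW ψ (i + 1)).length = (piW ψ i).length + ((piW ψ i).length + 1) := by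
            rw [e']; simp
          rw [hlen]
          refine ⟨pal_extend (ih1 i le_rfl) le_rfl ?_, by omega⟩
          intro x hx
          rw [← hget i x (by omega), ← hget (i + 1) (x + ((piW ψ i).length + 1)) (by omega)]
          simp only [e']
          rw [List.getElem_append_right (by omega)]
          simp [show x + ((piW ψ i).length + 1) - (piW ψ i).length = x + 1 by omega]
        · have e' := hr i j e
          have hji := hadm i j e
          have hjl := ih2 j hji.le
          have hlen : (piW ψ (i + 1)).length =
              (piW ψ i).length + ((piW ψ i).length - (piW ψ j).length) := by
            rw [e']; simp
          rw [hlen]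
          refine ⟨pal_extend (ih1 i le_rfl) (by omega) ?_, by omega⟩
          intro x hx
          by_cases c : x < (piW ψ j).length
          · refine per_of_pal (ih1 i le_rfl) (by omega) ?_ x (by omega)
            rw [show (piW ψ i).length - ((piW ψ i).length - (piW ψ j).length)
              = (piW ψ j).length by omega]
            exact ih1 j hji.le
          · rw [← hget i x (by omega), ← hget (i + 1) (x + ((piW ψ i).length - (piW ψ j).length)) (by omega)]
            simp only [e']
            rw [List.getElem_append_right (by omega)]
            rw [List.getElem_drop]
            congr 1; omega
      constructor
      · intro k hk
        rcases Nat.lt_or_ge i k with h' | h'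
        · obtain rfl : k = i + 1 := by omega
          exact main.1
        · exact ih1 k h'
      · intro k hk
        rcases Nat.lt_or_ge i k with h' | h'
        · obtain rfl : k = i + 1 := by omega
          exact le_rfl
        · exact (ih2 k h').trans main.2
  refine ⟨by simp [piW], fun i => (key i).1 i le_rfl, ?_⟩
  intro i
  rcases e : ψ i with a | j
  · left
    have e' := hl i a e
    have hlen : (piW ψ (i + 1)).length = 2 * (piW ψ i).length + 1 := by
      rw [e']; simp; omega
    refine ⟨?_, hlen⟩
    rw [← hget (i + 1) _ (by omega)]
    simp only [e']
    simp
  · right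
    have hji := hadm i j e
    refine ⟨j, hji, rfl, ?_⟩
    have := (key i).2 j hji.le
    simp only [hr i j e]
    simp; omega

theorem GoodSeq.pref_eq {A : Type*} {w : ℕ → A} {ψ : ℕ → A ⊕ ℕ} {n : ℕ → ℕ}
    (h : GoodSeq w ψ n) : ∀ i, piW ψ i = pref w (n i) := by
  intro i
  induction i using Nat.strong_induction_on with
  | _ i ih =>
    obtain _ | i := i
    · simp [piW, h.zero, pref]
    have hper := h.per i
    have ihi := ih i (by omega)
    rw [piW]
    rcases h.step i with ⟨e, es⟩ | ⟨j, hj, e, es⟩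
    · simp only [e]
      rw [ihi]
      apply List.ext_getElem
      · simp [pref_length]; omega
      · intro x h1 h2
        simp only [pref_length] at h2
        by_cases c : x < n i
        · rw [List.getElem_append_left (by simpa [pref_length] using c)]
          simp [pref]
        · rw [List.getElem_append_right (by simpa [pref_length] using c)]
          rw [List.getElem_cons]
          split_ifs with c2
          · simp [pref_length] at c2
            simp [pref]; congr 1; omega
          · simp [pref_length] at c2
            simp [pref]
            rw [hper _ (by omega)]; congr 1; omega
    · simp only [e]
      have hmj := h.mono hj
      rw [min_eq_left hj.le, ihi, ih j (by omega), pref_length]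
      apply List.ext_getElem
      · simp [pref_length]; omega
      · intro x h1 h2
        simp only [pref_length] at h2
        by_cases c : x < n i
        · rw [List.getElem_append_left (by simpa [pref_length] using c)]
          simp [pref]
        · rw [List.getElem_append_right (by simpa [pref_length] using c)]
          simp [pref]
          rw [hper _ (by omega)]; congr 1; omega

theorem GoodSeq.unique {A : Type*} {w : ℕ → A} {ψ ψ' : ℕ → A ⊕ ℕ} {n n' : ℕ → ℕ}
    (h : GoodSeq w ψ n) (h' : GoodSeq w ψ' n') (hred : Reduced ψ) (hred' : Reduced ψ') :
    ψ = ψ' := by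
  have hn : n = n' := by
    rw [← StrictMono.range_inj h.mono h'.mono]
    ext N
    constructor
    · rintro ⟨i, rfl⟩
      obtain ⟨j, hj⟩ := h'.all hred' _ (h.pal i)
      exact ⟨j, hj.symm⟩
    · rintro ⟨i, rfl⟩
      obtain ⟨j, hj⟩ := h.all hred _ (h'.pal i)
      exact ⟨j, hj.symm⟩
  subst hn
  funext i
  have hmono := h.mono
  rcases h.step i with ⟨e, es⟩ | ⟨j, _, e, es⟩
  · rcases h'.step i with ⟨f, fs⟩ | ⟨j', _, f, fs⟩
    · rw [e, f]
    · omega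
  · rcases h'.step i with ⟨f, fs⟩ | ⟨j', _, f, fs⟩
    · omega
    · rw [e, f]; congr 1
      exact hmono.injective (by omega)

theorem nth_goodSeq {A : Type*} (w : ℕ → A) (hinf : (setOf (palP w)).Infinite)
    (hab : ∀ i, Nat.nth (palP w) (i + 1) ≤ 2 * Nat.nth (palP w) i + 1) :
    ∃ ψ, GoodSeq w ψ (Nat.nth (palP w)) := by
  have hmono := Nat.nth_strictMono hinf
  have hpal : ∀ i, WPal w (Nat.nth (palP w) i) := fun i =>
    (palP_iff _ _).1 (Nat.nth_mem_of_infinite hinf i)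
  have hall : ∀ N, WPal w N → ∃ i, N = Nat.nth (palP w) i := by
    intro N hN
    have : N ∈ Set.range (Nat.nth (palP w)) := by
      rw [Nat.range_nth_of_infinite hinf]; exact (palP_iff _ _).2 hN
    obtain ⟨i, hi⟩ := this
    exact ⟨i, hi.symm⟩
  have hex : ∀ i, ∃ s : A ⊕ ℕ,
      (s = Sum.inl (w (Nat.nth (palP w) i)) ∧
        Nat.nth (palP w) (i + 1) = 2 * Nat.nth (palP w) i + 1) ∨
      ∃ j, j < i ∧ s = Sum.inr j ∧
        Nat.nth (palP w) (i + 1) + Nat.nth (palP w) j = 2 * Nat.nth (palP w) i := by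
    intro i
    rcases (hab i).lt_or_eq with hlt | he
    · have hm := hmono (Nat.lt_succ_self i)
      simp at hm
      have hper := per_of_pal (p := Nat.nth (palP w) (i + 1) - Nat.nth (palP w) i)
        (hpal (i + 1)) (by omega) (by
          rw [show Nat.nth (palP w) (i + 1) - (Nat.nth (palP w) (i + 1) - Nat.nth (palP w) i) =
            Nat.nth (palP w) i by omega]
          exact hpal i)
      obtain ⟨j, hj⟩ := hall _ (pal_of_per (hpal i) (per_mono hper (by omega)))
      refine ⟨Sum.inr j, Or.inr ⟨j, ?_, rfl, by omega⟩⟩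
      rw [← hmono.lt_iff_lt]; omega
    · exact ⟨_, Or.inl ⟨rfl, he⟩⟩
  choose ψ hψ using hex
  refine ⟨ψ, ?_, hpal, hψ⟩
  obtain ⟨i, hi⟩ := hall 0 (by intro x y hxy; omega)
  have := hmono.monotone (Nat.zero_le i)
  omega

theorem stmt11 {A : Type*} (w : ℕ → A) (hinf : (setOf (palP w)).Infinite) :
    ((∀ i, Nat.nth (palP w) (i + 1) ≤ 2 * Nat.nth (palP w) i + 1) ↔
      ∃ ψ : ℕ → A ⊕ ℕ, Admissible ψ ∧ Reduced ψ ∧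
        ∀ i, pref w (piW ψ i).length = piW ψ i) ∧
    ∀ ψ ψ' : ℕ → A ⊕ ℕ, Admissible ψ → Reduced ψ → Admissible ψ' → Reduced ψ' →
      (∃ v : ℕ → A, (∀ i, pref v (piW ψ i).length = piW ψ i) ∧
        (∀ i, pref v (piW ψ' i).length = piW ψ' i)) →
      ψ = ψ' := by
  constructor
  · constructor
    · intro hab
      obtain ⟨ψ, h⟩ := nth_goodSeq w hinf hab
      refine ⟨ψ, ?_, ?_, ?_⟩
      · intro i j e
        rcases h.step i with ⟨f, _⟩ | ⟨j', hj, f, _⟩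
        · rw [e] at f; cases f
        · rw [e] at f; cases f; exact hj
      · apply h.reduced
        intro N hN
        have : N ∈ Set.range (Nat.nth (palP w)) := by
          rw [Nat.range_nth_of_infinite hinf]; exact (palP_iff _ _).2 hN
        obtain ⟨i, hi⟩ := this
        exact ⟨i, hi.symm⟩
      · intro i
        rw [h.pref_eq i, pref_length]
    · rintro ⟨ψ, hadm, hred, hp⟩
      have h := goodSeq_of_pref hadm hp
      have hn : (fun i => (piW ψ i).length) = Nat.nth (palP w) := by
        rw [← StrictMono.range_inj h.mono (Nat.nth_strictMono hinf),
          Nat.range_nth_of_infinite hinf]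
        ext N
        constructor
        · rintro ⟨i, rfl⟩
          exact (palP_iff _ _).2 (h.pal i)
        · intro hN
          obtain ⟨j, hj⟩ := h.all hred _ ((palP_iff _ _).1 hN)
          exact ⟨j, hj.symm⟩
      rw [hn] at h
      intro i
      rcases h.step i with ⟨_, e⟩ | ⟨j, _, _, e⟩ <;> omega
  · rintro ψ ψ' ha hr ha' hr' ⟨v, hv, hv'⟩
    exact (goodSeq_of_pref ha hv).unique (goodSeq_of_pref ha' hv') hr hr'
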